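/- Let Ω ⊂ ℝ² be a bounded open set with smooth boundary, and for each i let V_i, W_i : Ω̄ → ℝ and u_i, v_i ∈ C²(Ω̄) satisfy -Δu_i = V_i e^{v_i} and -Δv_i = W_i e^{u_i} in Ω, u_i = 0 and v_i = 0 on ∂Ω, with 0 ≤ V_i ≤ b₁, 0 ≤ W_i ≤ b₂, ∫_Ω e^{u_i} dx ≤ C₁, ∫_Ω e^{v_i} dx ≤ C₂. Suppose the measures V_i e^{v_i} dx converge weakly-* (against continuous functions on Ω̄) to a nonnegative finite measure μ₁ on Ω̄, and let x₀ ∈ Ω be an interior point with μ₁({x₀}) < 4π. Then there exist R > 0 and a constant C such that sup_{B_R(x₀)} u_i ≤ C and sup_{B_R(x₀)} v_i ≤ C for all i. -/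

import Mathlib

open MeasureTheory Real Filter Topology Metric Set
open scoped RealInnerProductSpace ENNReal NNReal

noncomputable section

abbrev E2 : Type := EuclideanSpace ℝ (Fin 2)

/-- The Laplacian `Δ = ∂₁₁ + ∂₂₂` on `ℝ²`. -/
noncomputable def lap (u : E2 → ℝ) (x : E2) : ℝ :=
  ∑ i : Fin 2,
    fderiv ℝ (fun y => fderiv ℝ u y (EuclideanSpace.single i 1)) x (EuclideanSpace.single i 1)

/-- A planar set has smooth boundary: near each boundary point the set is the sublevel set
of a smooth local defining function with nonvanishing derivative. -/
def SmoothBoundary (Ω : Set E2) : Prop :=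
  ∀ x ∈ frontier Ω, ∃ (U : Set E2) (f : E2 → ℝ),
    IsOpen U ∧ x ∈ U ∧ ContDiff ℝ (⊤ : ℕ∞) f ∧ (∀ y ∈ U, fderiv ℝ f y ≠ 0) ∧
    Ω ∩ U = {y ∈ U | f y < 0} ∧ frontier Ω ∩ U = {y ∈ U | f y = 0}

/-! ### Part 1: the regularised logarithmic kernel and its Laplacian -/

lemma cont_dd {U : E2 → ℝ} (hU : ContDiff ℝ 2 U) (w : E2) :
    ContDiff ℝ 1 (fun y => fderiv ℝ U y w) :=
  (hU.fderiv_right (m := 1) (by norm_num)).clm_apply contDiff_const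

lemma cont_lap {U : E2 → ℝ} (hU : ContDiff ℝ 2 U) : Continuous (lap U) := by
  unfold lap
  refine continuous_finsetSum _ fun i _ => ?_
  have h := cont_dd hU (EuclideanSpace.single i 1)
  exact ((h.fderiv_right (m := 0) (by norm_num)).clm_apply contDiff_const).continuous

lemma ibp_one (G D H U : E2 → ℝ) (w : E2) (r : ℝ)
    (hGd : Differentiable ℝ G) (hD : ∀ y, fderiv ℝ G y w = D y)
    (hDd : Differentiable ℝ D) (hH : ∀ y, fderiv ℝ D y w = H y) (hHc : Continuous H)
    (sG : ∀ y ∉ closedBall (0 : E2) r, G y = 0) (sD : ∀ y ∉ closedBall (0 : E2) r, D y = 0)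
    (sH : ∀ y ∉ closedBall (0 : E2) r, H y = 0) (hU : ContDiff ℝ 2 U) :
    ∫ y, G y * fderiv ℝ (fun z => fderiv ℝ U z w) y w = ∫ y, H y * U y := by
  have hU1 := cont_dd hU w
  have hU1c := hU1.continuous
  have hUc := hU.continuous
  have hU2c : Continuous (fun y => fderiv ℝ (fun z => fderiv ℝ U z w) y w) :=
    ((hU1.fderiv_right (m := 0) (by norm_num)).clm_apply contDiff_const).continuous
  have key : ∀ A B : E2 → ℝ, Continuous A → Continuous B →
      (∀ y ∉ closedBall (0 : E2) r, A y = 0) → Integrable (fun y => A y * B y) := by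
    intro A B hA hB hs
    refine (hA.mul hB).integrable_of_hasCompactSupport
      (HasCompactSupport.intro (isCompact_closedBall (0 : E2) r) fun y hy => ?_)
    simp [hs y hy]
  have e1 := integral_mul_fderiv_eq_neg_fderiv_mul_of_integrable (μ := (volume : Measure E2))
    (f := G) (g := fun z => fderiv ℝ U z w) (v := w)
    (by simp only [hD]; exact key _ _ hDd.continuous hU1c sD)
    (key _ _ hGd.continuous hU2c sG) (key _ _ hGd.continuous hU1c sG)
    (fun x _ => hGd x) (fun x _ => (hU1.differentiable (by norm_num)) x)
  have e2 := integral_mul_fderiv_eq_neg_fderiv_mul_of_integrable (μ := (volume : Measure E2))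
    (f := D) (g := U) (v := w)
    (by simp only [hH]; exact key _ _ hHc hUc sH)
    (key _ _ hDd.continuous hU1c sD) (key _ _ hDd.continuous hUc sD)
    (fun x _ => hDd x) (fun x _ => (hU.differentiable (by norm_num)) x)
  rw [e1]; simp only [hD]; rw [e2]; simp only [hH, neg_neg]

lemma hasDerivAt_pos_sq (t : ℝ) : HasDerivAt (fun t : ℝ => (max t 0) ^ 2) (2 * max t 0) t := by
  rcases lt_trichotomy t 0 with h | h | h
  · have : (fun t : ℝ => (max t 0) ^ 2) =ᶠ[𝓝 t] fun _ => 0 := by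
      filter_upwards [Iio_mem_nhds h] with s hs
      simp [max_eq_right (le_of_lt (mem_Iio.1 hs))]
    rw [max_eq_right h.le, mul_zero]
    exact (hasDerivAt_const t (0 : ℝ)).congr_of_eventuallyEq this
  · subst h
    have h1 : HasDerivAt (fun t : ℝ => t * max t 0) (max (0 : ℝ) 0) 0 := by
      rw [hasDerivAt_iff_tendsto_slope]
      have hc : Tendsto (fun t : ℝ => max t 0) (𝓝[≠] 0) (𝓝 (max 0 0)) :=
        ((continuous_id.max continuous_const).tendsto (0 : ℝ)).mono_left nhdsWithin_le_nhds
      refine hc.congr' ?_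
      filter_upwards [self_mem_nhdsWithin] with s hs
      have : s ≠ 0 := hs
      simp [slope_def_field, this]
    have e : (fun t : ℝ => (max t 0) ^ 2) = fun t : ℝ => t * max t 0 := by
      ext s
      rcases le_total s 0 with h | h
      · simp [max_eq_right h]
      · simp [max_eq_left h, sq]
    rw [e]; simpa using h1
  · have : (fun t : ℝ => (max t 0) ^ 2) =ᶠ[𝓝 t] fun s => s ^ 2 := by
      filter_upwards [Ioi_mem_nhds h] with s hs
      simp [max_eq_left (le_of_lt (mem_Ioi.1 hs))]
    rw [max_eq_left h.le]
    simpa using (hasDerivAt_pow 2 t).congr_of_eventuallyEq this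

/-- cut-off profile -/
def kap (a s : ℝ) : ℝ := (max (1 - s / a) 0) ^ 2

/-- regularised log profile -/
def Fk (a ε s : ℝ) : ℝ := ∫ t in s..a, kap a t / (4 * π * (max t 0 + ε))

/-- derivative profile -/
def Ak (a ε s : ℝ) : ℝ := -(kap a s / (4 * π * (s + ε)))

def Ak' (a ε s : ℝ) : ℝ :=
  (2 / a * max (1 - s / a) 0) / (4 * π * (s + ε)) + kap a s / (4 * π * (s + ε) ^ 2)

lemma kap_cont (a : ℝ) : Continuous (kap a) := by unfold kap; fun_prop

lemma kap_hasDeriv (a s : ℝ) :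
    HasDerivAt (kap a) (-(2 / a * max (1 - s / a) 0)) s := by
  have h1 : HasDerivAt (fun s : ℝ => 1 - s / a) (-(1 / a)) s := by
    simpa using ((hasDerivAt_id s).div_const a).const_sub 1
  have := (hasDerivAt_pos_sq (1 - s / a)).comp s h1
  exact this.congr_deriv (by ring)

lemma Fk_hasDeriv {a ε s : ℝ} (hε : 0 < ε) (hs : 0 ≤ s) :
    HasDerivAt (Fk a ε) (Ak a ε s) s := by
  have hc : Continuous fun t => kap a t / (4 * π * (max t 0 + ε)) := by
    refine (kap_cont a).div (by fun_prop) fun t => ?_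
    have : 0 < max t 0 + ε := by positivity
    positivity
  have := intervalIntegral.integral_hasDerivAt_left (hc.intervalIntegrable s a)
    (hc.stronglyMeasurableAtFilter _ _) hc.continuousAt
  rw [max_eq_left hs] at this
  exact this

lemma Ak_hasDeriv {a ε s : ℝ} (hε : 0 < ε) (hs : 0 ≤ s) :
    HasDerivAt (Ak a ε) (Ak' a ε s) s := by
  have hp : 0 < s + ε := by positivity
  have h1 : HasDerivAt (fun s : ℝ => 4 * π * (s + ε)) (4 * π) s := by
    simpa using ((hasDerivAt_id s).add_const ε).const_mul (4 * π)
  have := ((kap_hasDeriv a s).div h1 (by positivity)).neg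
  refine this.congr_deriv ?_
  unfold Ak'
  have hpi := pi_pos.ne'
  have := hp.ne'
  field_simp
  ring

lemma kap_zero {a s : ℝ} (ha : 0 < a) (hs : a ≤ s) : kap a s = 0 := by
  have : 1 - s / a ≤ 0 := by rw [sub_nonpos, le_div_iff₀ ha]; simpa using hs
  simp [kap, max_eq_right this]

lemma max_zero' {a s : ℝ} (ha : 0 < a) (hs : a ≤ s) : max (1 - s / a) 0 = 0 := by
  have : 1 - s / a ≤ 0 := by rw [sub_nonpos, le_div_iff₀ ha]; simpa using hs
  simp [max_eq_right this]

lemma Fk_zero {a ε s : ℝ} (ha : 0 < a) (hs : a ≤ s) : Fk a ε s = 0 := by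
  unfold Fk
  rw [intervalIntegral.integral_congr (g := fun _ => 0)]
  · simp
  · intro t ht
    rw [uIcc_of_ge hs] at ht
    simp [kap_zero ha ht.1]

lemma kap_le_one {a s : ℝ} (ha : 0 < a) (hs : 0 ≤ s) : kap a s ≤ 1 := by
  have h0 : 0 ≤ max (1 - s / a) 0 := le_max_right _ _
  have h1 : max (1 - s / a) 0 ≤ 1 := max_le (by have := div_nonneg hs ha.le; linarith) zero_le_one
  unfold kap; nlinarith

lemma Fk_le {a ε s : ℝ} (hε : 0 < ε) (hs : 0 < s) (hsa : s < a) :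
    Fk a ε s ≤ 1 / (4 * π) * Real.log (a / s) := by
  have ha : 0 < a := hs.trans hsa
  have h0 : (0 : ℝ) ∉ uIcc s a := by rw [uIcc_of_le hsa.le]; intro h; linarith [h.1]
  rw [← integral_one_div h0, ← intervalIntegral.integral_const_mul]
  unfold Fk
  have hc : Continuous fun t => kap a t / (4 * π * (max t 0 + ε)) := by
    refine (kap_cont a).div (by fun_prop) fun t => ?_
    have : 0 < max t 0 + ε := by positivity
    positivity
  refine intervalIntegral.integral_mono_on hsa.le (hc.intervalIntegrable _ _) ?_ ?_
  · refine ContinuousOn.intervalIntegrable ?_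
    refine continuousOn_const.mul (continuousOn_const.div continuousOn_id ?_)
    intro x hx h; apply h0; rw [← show x = 0 from h]; exact hx
  · intro t ht
    have ht0 : 0 < t := hs.trans_le ht.1
    rw [max_eq_left ht0.le, div_mul_div_comm]
    have := kap_le_one ha ht0.le
    have : 0 ≤ kap a t := by unfold kap; positivity
    gcongr
    · simpa
    · linarith

lemma Gk_deriv {a ε : ℝ} (hε : 0 < ε) (y : E2) :
    HasFDerivAt (fun y : E2 => Fk a ε (‖y‖ ^ 2)) (Ak a ε (‖y‖ ^ 2) • (2 • innerSL ℝ y)) y :=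
  (Fk_hasDeriv hε (by positivity)).comp_hasFDerivAt y (hasStrictFDerivAt_norm_sq y).hasFDerivAt

lemma inner_single' (y : E2) (i : Fin 2) : inner ℝ y (EuclideanSpace.single i (1 : ℝ)) = y i := by
  simp [EuclideanSpace.inner_single_right]

lemma Dk_deriv {a ε : ℝ} (hε : 0 < ε) (i : Fin 2) (y : E2) :
    HasFDerivAt (fun y : E2 => 2 * y i * Ak a ε (‖y‖ ^ 2))
      ((2 * y i) • (Ak' a ε (‖y‖ ^ 2) • (2 • innerSL ℝ y))
        + (Ak a ε (‖y‖ ^ 2)) • ((2 : ℝ) • (EuclideanSpace.proj i : E2 →L[ℝ] ℝ))) y := by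
  have h1 := (Ak_hasDeriv (a := a) hε (by positivity : (0:ℝ) ≤ ‖y‖ ^ 2)).comp_hasFDerivAt y
    (hasStrictFDerivAt_norm_sq y).hasFDerivAt
  have h2 : HasFDerivAt (fun y : E2 => 2 * y i) ((2 : ℝ) • (EuclideanSpace.proj i : E2 →L[ℝ] ℝ)) y :=
    (EuclideanSpace.proj i : E2 →L[ℝ] ℝ).hasFDerivAt.const_mul 2
  exact h2.mul h1

lemma ibp_kernel {a ε r : ℝ} (hr : 0 < r) (ha : a = r ^ 2) (hε : 0 < ε) {U : E2 → ℝ}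
    (hU : ContDiff ℝ 2 U) :
    ∫ y, Fk a ε (‖y‖ ^ 2) * lap U y =
      ∫ y, (4 * Ak a ε (‖y‖ ^ 2) + 4 * ‖y‖ ^ 2 * Ak' a ε (‖y‖ ^ 2)) * U y := by
  have ha0 : 0 < a := by rw [ha]; positivity
  have hout : ∀ y : E2, y ∉ closedBall (0 : E2) r → a ≤ ‖y‖ ^ 2 := by
    intro y hy
    have : r < ‖y‖ := by simpa using hy
    rw [ha]; gcongr
  have hFc : Continuous fun y : E2 => Fk a ε (‖y‖ ^ 2) :=
    (show Differentiable ℝ fun y : E2 => Fk a ε (‖y‖ ^ 2) from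
      fun y => (Gk_deriv hε y).differentiableAt).continuous
  have hne : ∀ y : E2, (‖y‖ ^ 2 + ε) ≠ 0 := fun y => by positivity
  have hAc : Continuous fun y : E2 => Ak a ε (‖y‖ ^ 2) := by
    unfold Ak
    refine (((kap_cont a).comp (by fun_prop)).div (by fun_prop) fun y => ?_).neg
    have := hne y; have := pi_pos; positivity
  have hA'c : Continuous fun y : E2 => Ak' a ε (‖y‖ ^ 2) := by
    unfold Ak'
    refine Continuous.add ?_ ?_
    · refine Continuous.div (by fun_prop) (by fun_prop) fun y => ?_
      have := hne y; have := pi_pos; positivity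
    · refine ((kap_cont a).comp (by fun_prop)).div (by fun_prop) fun y => ?_
      have := hne y; have := pi_pos; positivity
  have sA : ∀ y ∉ closedBall (0 : E2) r, Ak a ε (‖y‖ ^ 2) = 0 := fun y hy => by
    simp [Ak, kap_zero ha0 (hout y hy)]
  have sA' : ∀ y ∉ closedBall (0 : E2) r, Ak' a ε (‖y‖ ^ 2) = 0 := fun y hy => by
    simp [Ak', kap_zero ha0 (hout y hy), max_zero' ha0 (hout y hy)]
  have step : ∀ i : Fin 2, ∫ y, Fk a ε (‖y‖ ^ 2) *
      fderiv ℝ (fun z => fderiv ℝ U z (EuclideanSpace.single i 1)) y (EuclideanSpace.single i 1)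
      = ∫ y, (2 * Ak a ε (‖y‖ ^ 2) + 4 * (y i) ^ 2 * Ak' a ε (‖y‖ ^ 2)) * U y := by
    intro i
    refine ibp_one _ (fun y => 2 * y i * Ak a ε (‖y‖ ^ 2)) _ U _ r
      (fun y => (Gk_deriv hε y).differentiableAt) ?_
      (fun y => (Dk_deriv hε i y).differentiableAt) ?_ ?_ ?_ ?_ ?_ hU
    · intro y
      rw [(Gk_deriv hε y).fderiv]
      simp [EuclideanSpace.inner_single_right]
      ring
    · intro y
      rw [(Dk_deriv hε i y).fderiv]
      simp [EuclideanSpace.inner_single_right]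
      ring
    · fun_prop
    · intro y hy; exact Fk_zero ha0 (hout y hy)
    · intro y hy; simp [sA y hy]
    · intro y hy; simp [sA y hy, sA' y hy]
  have hint : ∀ B C : E2 → ℝ, Continuous B → Continuous C →
      (∀ y ∉ closedBall (0 : E2) r, B y = 0) → Integrable (fun y => B y * C y) := by
    intro A B hA hB hs
    refine (hA.mul hB).integrable_of_hasCompactSupport
      (HasCompactSupport.intro (isCompact_closedBall (0 : E2) r) fun y hy => ?_)
    simp [hs y hy]
  unfold lap
  simp only [Finset.mul_sum]
  rw [integral_finsetSum]
  · simp only [step]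
    rw [← integral_finsetSum]
    · congr 1; ext y
      rw [EuclideanSpace.norm_sq_eq]
      simp only [Fin.sum_univ_two, Real.norm_eq_abs, sq_abs]
      ring
    · intro i _
      refine hint _ _ (by fun_prop) hU.continuous ?_
      intro y hy; simp [sA y hy, sA' y hy]
  · intro i _
    have h := cont_dd hU (EuclideanSpace.single i 1)
    exact hint _ _ hFc ((h.fderiv_right (m := 0) (by norm_num)).clm_apply contDiff_const).continuous
      (fun y hy => Fk_zero ha0 (hout y hy))

/-! ### Part 2: the pointwise representation inequality -/

lemma int_profile : ∫ y in Ioi (0 : ℝ), y / (1 + y ^ 2) ^ 2 = 1 / 2 := by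
  have hd : ∀ x ∈ Ici (0 : ℝ),
      HasDerivAt (fun y : ℝ => -(1 / (2 * (1 + y ^ 2)))) (x / (1 + x ^ 2) ^ 2) x := by
    intro x _
    have h1 : HasDerivAt (fun y : ℝ => 2 * (1 + y ^ 2)) (2 * (2 * x)) x := by
      simpa using ((hasDerivAt_pow 2 x).const_add 1).const_mul 2
    have := ((hasDerivAt_const x (1 : ℝ)).div h1 (by positivity)).neg
    refine this.congr_deriv ?_
    field_simp
    ring
  have hl : Tendsto (fun y : ℝ => -(1 / (2 * (1 + y ^ 2)))) atTop (𝓝 0) := by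
    have : Tendsto (fun y : ℝ => 2 * (1 + y ^ 2)) atTop atTop := by
      refine Tendsto.const_mul_atTop (by norm_num) ?_
      exact tendsto_atTop_add_const_left _ _ (tendsto_pow_atTop (by norm_num))
    simpa using this.inv_tendsto_atTop.neg
  rw [integral_Ioi_of_hasDerivAt_of_nonneg' hd ?_ hl]
  · norm_num
  · intro x hx
    have : (0 : ℝ) < x := hx
    positivity

def phik (z : E2) : ℝ := 1 / (π * (1 + ‖z‖ ^ 2) ^ 2)

lemma fr2 : Module.finrank ℝ E2 = 2 := by simp

lemma int_phik : ∫ z, phik z = 1 := by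
  have h := integral_fun_norm_addHaar (volume : Measure E2)
    (fun y : ℝ => 1 / (π * (1 + y ^ 2) ^ 2))
  unfold phik
  rw [h, fr2]
  have e : ∀ y : ℝ, y ^ (2 - 1) • (1 / (π * (1 + y ^ 2) ^ 2)) = 1 / π * (y / (1 + y ^ 2) ^ 2) := by
    intro y
    have := pi_pos.ne'
    have : (1 + y ^ 2) ≠ 0 := by positivity
    simp; field_simp
  simp only [e]
  rw [integral_const_mul, int_profile]
  have hv : (volume : Measure E2).real (ball 0 1) = π := by
    simp [Measure.real, EuclideanSpace.volume_ball_fin_two, pi_pos.le]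
  rw [hv]
  have := pi_pos.ne'
  simp only [smul_eq_mul, nsmul_eq_mul]
  push_cast
  field_simp

lemma phik_decay : Tendsto (fun z : E2 => ‖z‖ ^ Module.finrank ℝ E2 * phik z)
    (Bornology.cobounded E2) (𝓝 0) := by
  rw [fr2]
  have h1 : Tendsto (fun z : E2 => ‖z‖) (Bornology.cobounded E2) atTop :=
    tendsto_norm_cobounded_atTop
  have h2 : Tendsto (fun z : E2 => (‖z‖ ^ 2)⁻¹) (Bornology.cobounded E2) (𝓝 0) :=
    ((tendsto_pow_atTop (by norm_num)).comp h1).inv_tendsto_atTop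
  refine squeeze_zero' (Eventually.of_forall fun z => ?_) ?_ h2
  · unfold phik; positivity
  · filter_upwards [h1.eventually_gt_atTop 0] with z hz
    unfold phik
    rw [mul_one_div, inv_eq_one_div, div_le_div_iff₀ (by positivity) (by positivity)]
    have hp : 1 ≤ π := by linarith [pi_gt_three]
    have : (‖z‖ ^ 2) * ‖z‖ ^ 2 ≤ (1 + ‖z‖ ^ 2) ^ 2 := by nlinarith [sq_nonneg ‖z‖]
    nlinarith [sq_nonneg (1 + ‖z‖ ^ 2)]

lemma approx_id {g : E2 → ℝ} (hg : Integrable g) (hc : ContinuousAt g 0) :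
    Tendsto (fun c : ℝ => ∫ y, (c ^ 2 * phik (c • y)) * g y) atTop (𝓝 (g 0)) := by
  have := tendsto_integral_comp_smul_smul_of_integrable (μ := (volume : Measure E2))
    (φ := phik) (fun z => by unfold phik; positivity) int_phik phik_decay hg hc
  rw [fr2] at this
  simpa [smul_eq_mul] using this

lemma kern_int {α r : ℝ} (hα : α < 2) (hr : 0 < r) :
    IntegrableOn (fun y : E2 => (r / ‖y‖) ^ α) (ball 0 r) := by
  rw [integrableOn_fun_norm_addHaar (volume : Measure E2) (f := fun t => (r / t) ^ α), fr2]
  have h1 : IntegrableOn (fun t : ℝ => r ^ α * t ^ (1 - α)) (Ioo 0 r) :=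
    ((intervalIntegral.integrableOn_Ioo_rpow_iff hr).2 (by linarith)).const_mul _
  refine h1.congr_fun (fun t ht => ?_) measurableSet_Ioo
  have h0 : 0 < t := ht.1
  simp only [smul_eq_mul]
  rw [Real.div_rpow hr.le h0.le, Real.rpow_sub h0, Real.rpow_one]
  have : (t ^ α) ≠ 0 := by positivity
  norm_num
  field_simp

lemma kern_int_at {α r : ℝ} (hα : α < 2) (hr : 0 < r) (x : E2) :
    IntegrableOn (fun y : E2 => (r / ‖y - x‖) ^ α) (ball x r) := by
  have h := (integrable_indicator_iff measurableSet_ball).2 (kern_int hα hr)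
  have h2 := h.comp_sub_right x
  rw [← integrable_indicator_iff measurableSet_ball]
  refine h2.congr (Eventually.of_forall fun y => ?_)
  simp only [indicator, mem_ball, dist_eq_norm, sub_zero]

lemma log_nonneg_ball {r : ℝ} (x y : E2) (hy : y ∈ ball x r) :
    0 ≤ Real.log (r / ‖y - x‖) := by
  rcases eq_or_ne y x with rfl | h
  · simp
  · have h0 : 0 < ‖y - x‖ := by rwa [norm_pos_iff, sub_ne_zero]
    have h1 : ‖y - x‖ < r := by rwa [← dist_eq_norm]
    exact Real.log_nonneg (by rw [le_div_iff₀ h0]; linarith)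

lemma log_int_at {r : ℝ} (hr : 0 < r) (x : E2) :
    IntegrableOn (fun y : E2 => Real.log (r / ‖y - x‖)) (ball x r) := by
  refine (kern_int_at (α := 1) (by norm_num) hr x).mono' ?_ ?_
  · exact (Measurable.log (by fun_prop)).aestronglyMeasurable
  · filter_upwards [ae_restrict_mem measurableSet_ball] with y hy
    rw [Real.norm_of_nonneg (log_nonneg_ball x y hy)]
    simpa using Real.log_le_rpow_div (x := r / ‖y - x‖) (by positivity) one_pos

lemma K_zero {U : E2 → ℝ} (hU : ContDiff ℝ 2 U) {r : ℝ} (hr : 0 < r)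
    (hpos : ∀ y ∈ ball (0 : E2) r, 0 ≤ -lap U y) :
    U 0 ≤ 2 / (π * r ^ 2) * (∫ y in ball (0 : E2) r, Real.exp (U y))
      + 1 / (2 * π) * ∫ y in ball (0 : E2) r, Real.log (r / ‖y‖) * (-lap U y) := by
  obtain ⟨a, ha⟩ : ∃ a, a = r ^ 2 := ⟨_, rfl⟩
  have ha0 : 0 < a := by rw [ha]; positivity
  have hout : ∀ y : E2, y ∉ ball (0 : E2) r → a ≤ ‖y‖ ^ 2 := by
    intro y hy
    have : r ≤ ‖y‖ := by simpa using hy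
    rw [ha]; gcongr
  have hcomp : ∀ B : E2 → ℝ, Continuous B → (∀ y ∉ ball (0 : E2) r, B y = 0) → Integrable B := by
    intro B hB hs
    refine hB.integrable_of_hasCompactSupport
      (HasCompactSupport.intro (isCompact_closedBall (0 : E2) r) fun y hy => ?_)
    exact hs y fun h => hy (ball_subset_closedBall h)
  set g : E2 → ℝ := fun y => kap a (‖y‖ ^ 2) * U y with hg
  have hkc : Continuous fun y : E2 => kap a (‖y‖ ^ 2) := (kap_cont a).comp (by fun_prop)
  have hgc : Continuous g := hkc.mul hU.continuous
  have hgi : Integrable g := hcomp g hgc fun y hy => by simp [hg, kap_zero ha0 (hout y hy)]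
  have hlim := approx_id hgi hgc.continuousAt
  have hg0 : g 0 = U 0 := by simp [hg, kap]
  rw [hg0] at hlim
  refine le_of_tendsto hlim ?_
  filter_upwards [eventually_gt_atTop 0] with c hc
  set ε : ℝ := 1 / c ^ 2 with hεdef
  have hε : 0 < ε := by positivity
  have hne : ∀ y : E2, (‖y‖ ^ 2 + ε) ≠ 0 := fun y => by positivity
  have hparts := ibp_kernel hr ha hε hU
  have hFc : Continuous fun y : E2 => Fk a ε (‖y‖ ^ 2) :=
    (show Differentiable ℝ fun y : E2 => Fk a ε (‖y‖ ^ 2) from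
      fun y => (Gk_deriv hε y).differentiableAt).continuous
  -- pointwise identity
  have hid : ∀ y : E2, c ^ 2 * phik (c • y) * g y =
      2 / (π * a) * ((‖y‖ ^ 2 / (‖y‖ ^ 2 + ε)) * max (1 - ‖y‖ ^ 2 / a) 0 * U y)
      - (4 * Ak a ε (‖y‖ ^ 2) + 4 * ‖y‖ ^ 2 * Ak' a ε (‖y‖ ^ 2)) * U y := by
    intro y
    have e1 : c ^ 2 * phik (c • y) = ε / (π * (‖y‖ ^ 2 + ε) ^ 2) := by
      unfold phik
      have h1 : ‖y‖ ^ 2 + ε = (1 + ‖c • y‖ ^ 2) / c ^ 2 := by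
        rw [norm_smul, Real.norm_of_nonneg hc.le, hεdef]; field_simp; ring
      rw [h1, hεdef]
      have : 1 + ‖c • y‖ ^ 2 ≠ 0 := by positivity
      have := pi_pos.ne'
      field_simp
    rw [e1, hg]
    simp only [Ak, Ak']
    have := hne y
    have := pi_pos.ne'
    field_simp
    ring
  have i1 : Integrable fun y : E2 =>
      (‖y‖ ^ 2 / (‖y‖ ^ 2 + ε)) * max (1 - ‖y‖ ^ 2 / a) 0 * U y := by
    refine hcomp _ ?_ fun y hy => by simp [max_zero' ha0 (hout y hy)]
    refine Continuous.mul (Continuous.mul (Continuous.div (by fun_prop) (by fun_prop) hne)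
      (by fun_prop)) hU.continuous
  have i0 : Integrable fun y => c ^ 2 * phik (c • y) * g y := by
    refine hcomp _ ?_ fun y hy => by simp [hg, kap_zero ha0 (hout y hy)]
    refine Continuous.mul (Continuous.mul continuous_const ?_) hgc
    unfold phik
    refine Continuous.div (by fun_prop) (by fun_prop) fun y => ?_
    have := pi_pos
    positivity
  have i2 : Integrable fun y : E2 =>
      (4 * Ak a ε (‖y‖ ^ 2) + 4 * ‖y‖ ^ 2 * Ak' a ε (‖y‖ ^ 2)) * U y := by
    have := (i1.const_mul (2 / (π * a))).sub i0
    refine this.congr (Eventually.of_forall fun y => ?_)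
    simp only [Pi.sub_apply, hid y]; ring
  have hexp : IntegrableOn (fun y => Real.exp (U y)) (ball (0 : E2) r) :=
    ((Real.continuous_exp.comp hU.continuous).continuousOn.integrableOn_compact
      (isCompact_closedBall (0 : E2) r)).mono_set ball_subset_closedBall
  have hlog : IntegrableOn (fun y : E2 => Real.log (r / ‖y‖) * (-lap U y)) (ball 0 r) := by
    have h := log_int_at hr (0 : E2)
    simp only [sub_zero] at h
    exact h.mul_continuousOn_of_subset (cont_lap hU).neg.continuousOn measurableSet_ball
      (isCompact_closedBall (0 : E2) r) ball_subset_closedBall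
  simp only [hid]
  rw [integral_sub (i1.const_mul _) i2, ← hparts, integral_const_mul, ← ha, sub_eq_add_neg,
    ← integral_neg]
  refine add_le_add ?_ ?_
  · refine mul_le_mul_of_nonneg_left ?_ (by positivity)
    rw [← setIntegral_eq_integral_of_forall_compl_eq_zero (s := ball (0 : E2) r)
      (fun y hy => by simp [max_zero' ha0 (hout y hy)])]
    refine setIntegral_mono_on i1.integrableOn hexp measurableSet_ball fun y hy => ?_
    have h1 : 0 ≤ ‖y‖ ^ 2 / (‖y‖ ^ 2 + ε) := by positivity
    have h2 : ‖y‖ ^ 2 / (‖y‖ ^ 2 + ε) ≤ 1 := by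
      rw [div_le_one (by positivity)]; linarith
    have h3 : 0 ≤ max (1 - ‖y‖ ^ 2 / a) 0 := le_max_right _ _
    have h4 : max (1 - ‖y‖ ^ 2 / a) 0 ≤ 1 :=
      max_le (by have : 0 ≤ ‖y‖ ^ 2 / a := by positivity
                 linarith) zero_le_one
    have h5 : U y ≤ Real.exp (U y) := by linarith [Real.add_one_le_exp (U y)]
    have h6 : 0 ≤ ‖y‖ ^ 2 / (‖y‖ ^ 2 + ε) * max (1 - ‖y‖ ^ 2 / a) 0 := mul_nonneg h1 h3
    have h7 : ‖y‖ ^ 2 / (‖y‖ ^ 2 + ε) * max (1 - ‖y‖ ^ 2 / a) 0 ≤ 1 := mul_le_one₀ h2 h3 h4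
    calc _ ≤ ‖y‖ ^ 2 / (‖y‖ ^ 2 + ε) * max (1 - ‖y‖ ^ 2 / a) 0 * Real.exp (U y) :=
          mul_le_mul_of_nonneg_left h5 h6
      _ ≤ 1 * Real.exp (U y) := mul_le_mul_of_nonneg_right h7 (Real.exp_pos _).le
      _ = _ := one_mul _
  · rw [← integral_const_mul]
    rw [← setIntegral_eq_integral_of_forall_compl_eq_zero (s := ball (0 : E2) r)
      (fun y hy => by simp [Fk_zero ha0 (hout y hy)])]
    refine setIntegral_mono_on_ae ?_ (hlog.const_mul _) measurableSet_ball ?_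
    · refine (Integrable.neg (hcomp _ (hFc.mul (cont_lap hU)) fun y hy => ?_)).integrableOn
      simp [Fk_zero ha0 (hout y hy)]
    · have h0 : ∀ᵐ y : E2, y ≠ 0 := by
        rw [ae_iff]; simp
      filter_upwards [h0] with y hy0 hy
      have hn : 0 < ‖y‖ := norm_pos_iff.2 hy0
      have hlt : ‖y‖ < r := by simpa using hy
      have hF := Fk_le (a := a) (s := ‖y‖ ^ 2) hε (by positivity) (by rw [ha]; gcongr)
      have e : Real.log (a / ‖y‖ ^ 2) = 2 * Real.log (r / ‖y‖) := by
        rw [ha, ← div_pow, Real.log_pow]; norm_num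
      rw [e] at hF
      have := mul_le_mul_of_nonneg_right hF (hpos y hy)
      have hpi := pi_pos.ne'
      calc _ = Fk a ε (‖y‖ ^ 2) * (-lap U y) := by ring
        _ ≤ _ := this
        _ = _ := by field_simp; ring

/-! ### Part 3: localisation -/

lemma lap_congr {f g : E2 → ℝ} {x : E2} (h : f =ᶠ[𝓝 x] g) : lap f x = lap g x := by
  unfold lap
  refine Finset.sum_congr rfl fun i _ => ?_
  have : (fun y => fderiv ℝ f y (EuclideanSpace.single i 1)) =ᶠ[𝓝 x]
      fun y => fderiv ℝ g y (EuclideanSpace.single i 1) := by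
    filter_upwards [h.fderiv (𝕜 := ℝ)] with y hy
    rw [hy]
  rw [this.fderiv_eq]

lemma lap_translate (f : E2 → ℝ) (x y : E2) : lap (fun z => f (z + x)) y = lap f (y + x) := by
  unfold lap
  refine Finset.sum_congr rfl fun i _ => ?_
  have : (fun z => fderiv ℝ (fun z => f (z + x)) z (EuclideanSpace.single i 1)) =
      fun z => (fun w => fderiv ℝ f w (EuclideanSpace.single i 1)) (z + x) := by
    ext z; rw [fderiv_comp_add_right]
  rw [this, fderiv_comp_add_right (f := fun w => fderiv ℝ f w (EuclideanSpace.single i 1))]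

lemma setInt_translate (h : E2 → ℝ) (x : E2) (r : ℝ) :
    ∫ y in ball (0 : E2) r, h (y + x) = ∫ y in ball x r, h y := by
  rw [← integral_indicator measurableSet_ball, ← integral_indicator measurableSet_ball,
    ← integral_add_right_eq_self ((ball x r).indicator fun y => h y) x]
  congr 1; ext y
  simp [indicator, dist_eq_norm]

lemma K_local {Ω : Set E2} {u : E2 → ℝ} (hΩ : IsOpen Ω) (hu : ContDiffOn ℝ 2 u Ω)
    {x : E2} {r : ℝ} (hr : 0 < r) (hsub : closedBall x (2 * r) ⊆ Ω)
    (hpos : ∀ y ∈ Ω, 0 ≤ -lap u y) :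
    u x ≤ 2 / (π * r ^ 2) * (∫ y in ball x r, Real.exp (u y))
      + 1 / (2 * π) * ∫ y in ball x r, Real.log (r / ‖y - x‖) * (-lap u y) := by
  let ζ : ContDiffBump x := ⟨r, 2 * r, hr, by linarith⟩
  set Wf : E2 → ℝ := fun y => ζ y * u y with hW
  have hWc : ContDiff ℝ 2 Wf := by
    rw [contDiff_iff_contDiffAt]
    intro y
    by_cases hy : y ∈ Ω
    · exact ζ.contDiff.contDiffAt.mul (hu.contDiffAt (hΩ.mem_nhds hy))
    · have hy' : y ∈ (closedBall x (2 * r))ᶜ := fun h => hy (hsub h)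
      have : Wf =ᶠ[𝓝 y] fun _ => 0 := by
        filter_upwards [isClosed_closedBall.isOpen_compl.mem_nhds hy'] with z hz
        have hz' : 2 * r < dist z x := by simpa using hz
        simp [hW, ζ.zero_of_le_dist hz'.le]
      exact contDiffAt_const.congr_of_eventuallyEq this
  have heq : ∀ y ∈ ball x r, Wf y = u y := by
    intro y hy
    simp [hW, ζ.one_of_mem_closedBall (ball_subset_closedBall hy)]
  have hlap : ∀ y ∈ ball x r, lap Wf y = lap u y := by
    intro y hy
    apply lap_congr
    filter_upwards [isOpen_ball.mem_nhds hy] with z hz using heq z hz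
  have hbΩ : ball x r ⊆ Ω := (ball_subset_closedBall.trans
    (closedBall_subset_closedBall (by linarith))).trans hsub
  have hm : ∀ y ∈ ball (0 : E2) r, y + x ∈ ball x r := by
    intro y hy; simpa [dist_eq_norm] using hy
  have hK := K_zero (U := fun z => Wf (z + x)) (hWc.comp (by fun_prop)) hr (by
    intro y hy
    rw [lap_translate, hlap _ (hm y hy)]
    exact hpos _ (hbΩ (hm y hy)))
  simp only [lap_translate, zero_add] at hK
  rw [heq x (mem_ball_self hr)] at hK
  have t1 := setInt_translate (fun y => Real.exp (Wf y)) x r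
  have t2 := setInt_translate (fun y => Real.log (r / ‖y - x‖) * (-lap Wf y)) x r
  simp only [add_sub_cancel_right] at t2
  rw [t1, t2] at hK
  have c1 : ∫ y in ball x r, Real.exp (Wf y) = ∫ y in ball x r, Real.exp (u y) :=
    setIntegral_congr_fun measurableSet_ball fun y hy => by simp only [heq y hy]
  have c2 : ∫ y in ball x r, Real.log (r / ‖y - x‖) * (-lap Wf y) =
      ∫ y in ball x r, Real.log (r / ‖y - x‖) * (-lap u y) :=
    setIntegral_congr_fun measurableSet_ball fun y hy => by simp only [hlap y hy]
  rw [c1, c2] at hK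
  exact hK

/-! ### Part 4: Jensen and the convolution estimate -/

lemma jensen_tan {S : Set E2} (hS : MeasurableSet S) {f h k : E2 → ℝ} {θ : ℝ} (hθ : 0 < θ)
    (hf0 : ∀ y ∈ S, 0 ≤ f y) (hh0 : ∀ y ∈ S, 0 ≤ h y)
    (hk : ∀ᵐ y, y ∈ S → Real.exp (h y) ≤ k y)
    (hf : IntegrableOn f S) (hhf : IntegrableOn (fun y => h y * f y) S)
    (hkf : IntegrableOn (fun y => k y * f y) S) (hm : ∫ y in S, f y ≤ θ) :
    Real.exp (1 / θ * ∫ y in S, h y * f y) ≤ 1 + 1 / θ * ∫ y in S, k y * f y := by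
  set c : ℝ := 1 / θ * ∫ y in S, h y * f y with hc
  have hm0 : 0 ≤ ∫ y in S, f y := setIntegral_nonneg hS hf0
  have hhf0 : 0 ≤ ∫ y in S, h y * f y :=
    setIntegral_nonneg hS fun y hy => mul_nonneg (hh0 y hy) (hf0 y hy)
  have hc0 : 0 ≤ c := by positivity
  have hcθ : ∫ y in S, h y * f y = θ * c := by rw [hc]; field_simp
  have h1 : ∫ y in S, Real.exp c * ((1 - c) * f y + h y * f y) ≤ ∫ y in S, k y * f y := by
    refine setIntegral_mono_on_ae (((hf.const_mul _).add hhf).const_mul _) hkf hS ?_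
    filter_upwards [hk] with y hy hyS
    have e1 : Real.exp c * (1 + (h y - c)) ≤ Real.exp (h y) := by
      have := Real.add_one_le_exp (h y - c)
      calc _ ≤ Real.exp c * Real.exp (h y - c) := by
            apply mul_le_mul_of_nonneg_left _ (Real.exp_pos _).le; linarith
        _ = _ := by rw [← Real.exp_add]; ring_nf
    have := mul_le_mul_of_nonneg_right (e1.trans (hy hyS)) (hf0 y hyS)
    linarith
  rw [integral_const_mul, integral_add (hf.const_mul _) hhf, integral_const_mul, hcθ] at h1
  obtain ⟨m, hmdef⟩ : ∃ m, ∫ y in S, f y = θ * m := ⟨(∫ y in S, f y) / θ, by field_simp⟩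
  rw [hmdef] at h1 hm hm0
  have m1 : m ≤ 1 := by
    by_contra hcon; push Not at hcon; nlinarith
  have m0 : 0 ≤ m := by
    by_contra hcon; push Not at hcon; nlinarith
  have h2 : Real.exp c * ((1 - c) * m + c) ≤ 1 / θ * ∫ y in S, k y * f y := by
    rw [one_div, le_inv_mul_iff₀ hθ]
    calc _ = Real.exp c * ((1 - c) * (θ * m) + θ * c) := by ring
      _ ≤ _ := h1
  have h3 : Real.exp c * (1 - c) ≤ 1 := by
    have := Real.add_one_le_exp (-c)
    calc _ ≤ Real.exp c * Real.exp (-c) := by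
          apply mul_le_mul_of_nonneg_left _ (Real.exp_pos _).le; linarith
      _ = 1 := by rw [← Real.exp_add]; simp
  have h4 : Real.exp c * (1 - c) * (1 - m) ≤ 1 := by
    have hm' : 0 ≤ 1 - m := by linarith
    nlinarith
  nlinarith

/-- truncated power kernel -/
def kk (ρ γ : ℝ) (w : E2) : ℝ≥0∞ :=
  (ball (0 : E2) ρ).indicator (fun w => ENNReal.ofReal ((ρ / ‖w‖) ^ γ)) w

lemma kk_meas (ρ γ : ℝ) : Measurable (kk ρ γ) :=
  Measurable.indicator (by fun_prop) measurableSet_ball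

lemma kk_neg (ρ γ : ℝ) (w : E2) : kk ρ γ (-w) = kk ρ γ w := by
  simp [kk, indicator]

lemma kk_fin {ρ γ : ℝ} (hρ : 0 < ρ) (hγ : γ < 2) : ∫⁻ w, kk ρ γ w ≠ ∞ := by
  unfold kk
  rw [lintegral_indicator measurableSet_ball]
  exact ((kern_int hγ hρ).lintegral_lt_top).ne

lemma kk_mul {ρ β δ : ℝ} (hρ : 0 < ρ) (hβ : 0 < β) (hδ : 0 < δ) (a b : E2) :
    kk ρ δ a * kk ρ β b ≤ kk ρ (β + δ) a + kk ρ (β + δ) b := by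
  unfold kk
  by_cases ha : a ∈ ball (0 : E2) ρ
  · by_cases hb : b ∈ ball (0 : E2) ρ
    · simp only [indicator_of_mem ha, indicator_of_mem hb]
      have sa : 0 ≤ ρ / ‖a‖ := by positivity
      have sb : 0 ≤ ρ / ‖b‖ := by positivity
      rw [← ENNReal.ofReal_mul (by positivity), ← ENNReal.ofReal_add (by positivity) (by positivity)]
      apply ENNReal.ofReal_le_ofReal
      generalize ρ / ‖a‖ = s at *
      generalize ρ / ‖b‖ = t at *
      have hs : s ^ (β + δ) = s ^ β * s ^ δ := Real.rpow_add_of_nonneg sa hβ.le hδ.le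
      have ht : t ^ (β + δ) = t ^ β * t ^ δ := Real.rpow_add_of_nonneg sb hβ.le hδ.le
      rcases le_total s t with h | h
      · have h1 : s ^ δ ≤ t ^ δ := Real.rpow_le_rpow sa h hδ.le
        have h2 : 0 ≤ t ^ β := by positivity
        have h3 : 0 ≤ s ^ (β + δ) := by positivity
        rw [ht]; nlinarith
      · have h1 : t ^ β ≤ s ^ β := Real.rpow_le_rpow sb h hβ.le
        have h2 : 0 ≤ s ^ δ := by positivity
        have h3 : 0 ≤ t ^ (β + δ) := by positivity
        rw [hs]; nlinarith
    · simp [indicator_of_notMem hb]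
  · simp [indicator_of_notMem ha]

lemma ofReal_integral_le {S : Set E2} (hS : MeasurableSet S) {h : E2 → ℝ}
    (h0 : ∀ y ∈ S, 0 ≤ h y) :
    ENNReal.ofReal (∫ y in S, h y) ≤ ∫⁻ y in S, ENNReal.ofReal (h y) := by
  calc _ ≤ ‖∫ y in S, h y‖ₑ := Real.ofReal_le_enorm _
    _ ≤ ∫⁻ y in S, ‖h y‖ₑ := enorm_integral_le_lintegral_enorm _
    _ = _ := setLIntegral_congr_fun hS fun y hy => Real.enorm_of_nonneg (h0 y hy)

lemma conv_bound {ρ β θ K : ℝ} (hρ : 0 < ρ) (hβ : 0 < β) (hβ2 : β < 2) (hθ : 0 < θ) (hK : 0 ≤ K) :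
    ∃ C : ℝ, ∀ (x : E2) (B : Set E2) (u f : E2 → ℝ), MeasurableSet B → (∀ y ∈ B, 0 ≤ f y) →
      IntegrableOn f B → ∫ y in B, f y ≤ θ → (∀ z ∈ ball x ρ, ball z ρ ⊆ B) →
      (∀ z ∈ ball x ρ, Real.exp (u z) ≤
        K * (1 + 1 / θ * ∫ y in ball z ρ, (ρ / ‖y - z‖) ^ β * f y)) →
      ∫ z in ball x ρ, Real.log (ρ / ‖z - x‖) * Real.exp (u z) ≤ C := by
  obtain ⟨δ, hδ⟩ : ∃ δ, δ = (2 - β) / 2 := ⟨_, rfl⟩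
  have hδ0 : 0 < δ := by linarith
  have hα : β + δ < 2 := by linarith
  set I1 := ∫⁻ w, kk ρ δ w with hI1
  set I2 := ∫⁻ w, kk ρ (β + δ) w with hI2
  have f1 : I1 ≠ ∞ := kk_fin hρ (by linarith)
  have f2 : I2 ≠ ∞ := kk_fin hρ hα
  set T : ℝ≥0∞ := ENNReal.ofReal (1 / δ * K) *
    (I1 + ENNReal.ofReal (1 / θ) * (ENNReal.ofReal θ * (I2 + I2))) with hT
  have fT : T ≠ ∞ := by
    refine ENNReal.mul_ne_top ENNReal.ofReal_ne_top (ENNReal.add_ne_top.2 ⟨f1, ?_⟩)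
    refine ENNReal.mul_ne_top ENNReal.ofReal_ne_top (ENNReal.mul_ne_top ENNReal.ofReal_ne_top ?_)
    exact ENNReal.add_ne_top.2 ⟨f2, f2⟩
  refine ⟨T.toReal, fun x B u f hB hf0 hfi hfθ hzB hexp => ?_⟩
  rw [← ENNReal.ofReal_le_iff_le_toReal fT]
  set ff : E2 → ℝ≥0∞ := B.indicator fun y => ENNReal.ofReal (f y) with hff
  have hffm : AEMeasurable ff := by
    rw [hff, aemeasurable_indicator_iff hB]
    exact hfi.aemeasurable.ennreal_ofReal
  have hffi : ∫⁻ y, ff y ≤ ENNReal.ofReal θ := by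
    rw [hff, lintegral_indicator hB, ← ofReal_integral_eq_lintegral_ofReal hfi
      ((ae_restrict_mem hB).mono hf0)]
    exact ENNReal.ofReal_le_ofReal hfθ
  refine (ofReal_integral_le measurableSet_ball fun z hz =>
    mul_nonneg (log_nonneg_ball x z hz) (Real.exp_pos _).le).trans ?_
  have hpt : ∀ z ∈ ball x ρ, ENNReal.ofReal (Real.log (ρ / ‖z - x‖) * Real.exp (u z)) ≤
      ENNReal.ofReal (1 / δ * K) * (kk ρ δ (z - x) + ENNReal.ofReal (1 / θ) *
        ∫⁻ y, kk ρ δ (z - x) * kk ρ β (y - z) * ff y) := by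
    intro z hz
    have hP : ENNReal.ofReal (∫ y in ball z ρ, (ρ / ‖y - z‖) ^ β * f y) ≤
        ∫⁻ y, kk ρ β (y - z) * ff y := by
      refine (ofReal_integral_le measurableSet_ball fun y hy =>
        mul_nonneg (by positivity) (hf0 y (hzB z hz hy))).trans ?_
      rw [← lintegral_indicator measurableSet_ball]
      refine lintegral_mono fun y => ?_
      by_cases hy : y ∈ ball z ρ
      · rw [indicator_of_mem hy, ENNReal.ofReal_mul (by positivity)]
        have hyz : y - z ∈ ball (0 : E2) ρ := by simpa [dist_eq_norm] using hy
        simp only [kk, indicator_of_mem hyz, hff, indicator_of_mem (hzB z hz hy)]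
        exact le_rfl
      · rw [indicator_of_notMem hy]; exact zero_le
    have hzx : z - x ∈ ball (0 : E2) ρ := by simpa [dist_eq_norm] using hz
    have hk : kk ρ δ (z - x) = ENNReal.ofReal ((ρ / ‖z - x‖) ^ δ) := by
      simp only [kk, indicator_of_mem hzx]
    have hI0 : 0 ≤ ∫ y in ball z ρ, (ρ / ‖y - z‖) ^ β * f y :=
      setIntegral_nonneg measurableSet_ball fun y hy =>
        mul_nonneg (by positivity) (hf0 y (hzB z hz hy))
    have hlog : Real.log (ρ / ‖z - x‖) ≤ 1 / δ * (ρ / ‖z - x‖) ^ δ := by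
      have := Real.log_le_rpow_div (x := ρ / ‖z - x‖) (by positivity) hδ0
      rw [one_div, inv_mul_eq_div]; exact this
    have hmul : Real.log (ρ / ‖z - x‖) * Real.exp (u z) ≤ (1 / δ * K) * ((ρ / ‖z - x‖) ^ δ *
        (1 + 1 / θ * ∫ y in ball z ρ, (ρ / ‖y - z‖) ^ β * f y)) := by
      calc _ ≤ (1 / δ * (ρ / ‖z - x‖) ^ δ) *
            (K * (1 + 1 / θ * ∫ y in ball z ρ, (ρ / ‖y - z‖) ^ β * f y)) :=
            mul_le_mul hlog (hexp z hz) (Real.exp_pos _).le (by positivity)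
        _ = _ := by ring
    have hswap : ∫⁻ y, kk ρ δ (z - x) * kk ρ β (y - z) * ff y =
        kk ρ δ (z - x) * ∫⁻ y, kk ρ β (y - z) * ff y := by
      simp only [mul_assoc]
      rw [lintegral_const_mul' _ _ (by rw [hk]; exact ENNReal.ofReal_ne_top)]
    refine (ENNReal.ofReal_le_ofReal hmul).trans ?_
    rw [ENNReal.ofReal_mul (p := 1 / δ * K) (by positivity),
      ENNReal.ofReal_mul (p := (ρ / ‖z - x‖) ^ δ) (by positivity),
      ENNReal.ofReal_add zero_le_one (by positivity), ENNReal.ofReal_mul (p := 1 / θ) (by positivity),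
      ENNReal.ofReal_one, hswap, hk, mul_add, mul_one]
    rw [mul_left_comm (ENNReal.ofReal ((ρ / ‖z - x‖) ^ δ)) (ENNReal.ofReal (1 / θ))]
    gcongr
  have hmz : ∀ γ, Measurable (fun z : E2 => kk ρ γ (z - x)) :=
    fun γ => (kk_meas ρ γ).comp (measurable_id.sub_const x)
  have hm1 : AEMeasurable (fun p : E2 × E2 => kk ρ δ (p.1 - x) * kk ρ β (p.2 - p.1) * ff p.2)
      (volume.prod volume) := by
    refine AEMeasurable.mul (Measurable.aemeasurable ?_) hffm.comp_snd
    exact ((kk_meas ρ δ).comp (by fun_prop)).mul ((kk_meas ρ β).comp (by fun_prop))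
  calc _ ≤ ∫⁻ z in ball x ρ, ENNReal.ofReal (1 / δ * K) * (kk ρ δ (z - x) + ENNReal.ofReal (1 / θ) *
        ∫⁻ y, kk ρ δ (z - x) * kk ρ β (y - z) * ff y) :=
        setLIntegral_mono' measurableSet_ball hpt
    _ ≤ ∫⁻ z, ENNReal.ofReal (1 / δ * K) * (kk ρ δ (z - x) + ENNReal.ofReal (1 / θ) *
        ∫⁻ y, kk ρ δ (z - x) * kk ρ β (y - z) * ff y) := setLIntegral_le_lintegral _ _
    _ = ENNReal.ofReal (1 / δ * K) * (I1 + ENNReal.ofReal (1 / θ) *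
        ∫⁻ z, ∫⁻ y, kk ρ δ (z - x) * kk ρ β (y - z) * ff y) := by
        rw [lintegral_const_mul' _ _ ENNReal.ofReal_ne_top,
          lintegral_add_left (hmz δ),
          lintegral_const_mul' _ _ ENNReal.ofReal_ne_top,
          lintegral_sub_right_eq_self (fun w => kk ρ δ w) x]
    _ ≤ T := by
        rw [hT]
        gcongr
        rw [lintegral_lintegral_swap hm1]
        calc _ ≤ ∫⁻ y, ff y * (I2 + I2) := by
              refine lintegral_mono fun y => ?_
              calc ∫⁻ z, kk ρ δ (z - x) * kk ρ β (y - z) * ff y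
                  ≤ ∫⁻ z, (kk ρ (β + δ) (z - x) + kk ρ (β + δ) (y - z)) * ff y := by
                    refine lintegral_mono fun z => ?_
                    exact mul_le_mul_left (kk_mul hρ hβ hδ0 _ _) _
                _ = ff y * (I2 + I2) := by
                    rw [lintegral_mul_const' _ _ ?_, mul_comm,
                      lintegral_add_left (hmz (β + δ)),
                      lintegral_sub_right_eq_self (fun w => kk ρ (β + δ) w) x,
                      lintegral_sub_left_eq_self (fun w => kk ρ (β + δ) w) y]
                    rw [hff]
                    by_cases hy : y ∈ B <;> simp [hy]
          _ = (∫⁻ y, ff y) * (I2 + I2) :=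
              lintegral_mul_const' _ _ (ENNReal.add_ne_top.2 ⟨f2, f2⟩)
          _ ≤ _ := by gcongr

/-! ### Part 5: assembling -/

lemma lap_contOn {Ω : Set E2} (hΩ : IsOpen Ω) {u : E2 → ℝ} (hu : ContDiffOn ℝ 2 u Ω) :
    ContinuousOn (lap u) Ω := by
  unfold lap
  refine continuousOn_finsetSum _ fun i _ => ?_
  have h1 : ContDiffOn ℝ 1 (fun y => fderiv ℝ u y (EuclideanSpace.single i 1)) Ω :=
    (hu.fderiv_of_isOpen hΩ (m := 1) (by norm_num)).clm_apply contDiffOn_const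
  exact ((h1.fderiv_of_isOpen hΩ (m := 0) (by norm_num)).clm_apply contDiffOn_const).continuousOn

lemma K_use {Ω : Set E2} {w : E2 → ℝ} (hΩ : IsOpen Ω) (hΩb : Bornology.IsBounded Ω)
    (hw : ContDiffOn ℝ 2 w (closure Ω)) {C : ℝ} (hC : ∫ x in Ω, Real.exp (w x) ≤ C)
    {x : E2} {r : ℝ} (hr : 0 < r) (hsub : closedBall x (2 * r) ⊆ Ω)
    (hpos : ∀ y ∈ Ω, 0 ≤ -lap w y) :
    w x ≤ 2 / (π * r ^ 2) * C
      + 1 / (2 * π) * ∫ y in ball x r, Real.log (r / ‖y - x‖) * (-lap w y) := by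
  have hbΩ : ball x r ⊆ Ω := (ball_subset_closedBall.trans
    (closedBall_subset_closedBall (by linarith))).trans hsub
  have hint : IntegrableOn (fun x => Real.exp (w x)) Ω :=
    ((Real.continuous_exp.comp_continuousOn hw.continuousOn).integrableOn_compact
      hΩb.isCompact_closure).mono_set subset_closure
  have h1 : ∫ y in ball x r, Real.exp (w y) ≤ C :=
    (setIntegral_mono_set hint (Eventually.of_forall fun y => (Real.exp_pos _).le)
      hbΩ.eventuallyLE).trans hC
  refine (K_local hΩ (hw.mono subset_closure) hr hsub hpos).trans ?_
  gcongr

lemma int_log_mul {x : E2} {r : ℝ} (hr : 0 < r) {f : E2 → ℝ}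
    (hf : ContinuousOn f (closedBall x r)) :
    IntegrableOn (fun y => Real.log (r / ‖y - x‖) * f y) (ball x r) :=
  (log_int_at hr x).mul_continuousOn_of_subset hf measurableSet_ball
    (isCompact_closedBall x r) ball_subset_closedBall

lemma exists_radius {Ω : Set E2} (hΩ : IsOpen Ω) (μ : Measure E2) [IsFiniteMeasure μ] {x₀ : E2}
    (hx₀ : x₀ ∈ Ω) {M : ℝ} (hmass : μ {x₀} < ENNReal.ofReal M) :
    ∃ ρ > 0, closedBall x₀ (8 * ρ) ⊆ Ω ∧ μ.real (closedBall x₀ (5 * ρ)) < M := by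
  obtain ⟨r0, hr0, hr0Ω⟩ := Metric.nhds_basis_closedBall.mem_iff.1 (hΩ.mem_nhds hx₀)
  have ht := tendsto_measure_cthickening_of_isClosed (μ := μ) (s := {x₀})
    ⟨1, one_pos, measure_ne_top _ _⟩ isClosed_singleton
  have hev := ht.eventually (gt_mem_nhds hmass)
  obtain ⟨η, hη, hηb⟩ := Metric.eventually_nhds_iff.1 hev
  obtain ⟨ρ, hρ⟩ : ∃ ρ, ρ = min r0 η / 16 := ⟨_, rfl⟩
  have hmin : 0 < min r0 η := lt_min hr0 hη
  have h1 := min_le_left r0 η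
  have h2 := min_le_right r0 η
  have hρ0 : 0 < ρ := by rw [hρ]; positivity
  refine ⟨ρ, hρ0, (closedBall_subset_closedBall (by linarith)).trans hr0Ω, ?_⟩
  have h3 := hηb (y := 5 * ρ) (by
    rw [Real.dist_eq, sub_zero, abs_of_pos (by positivity)]; linarith)
  rw [cthickening_singleton _ (by positivity)] at h3
  have hM : 0 < M := by
    by_contra hcon
    rw [ENNReal.ofReal_of_nonpos (not_lt.1 hcon)] at hmass
    exact absurd hmass not_lt_zero
  exact (ENNReal.lt_ofReal_iff_toReal_lt (measure_ne_top _ _)).1 h3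

lemma exists_mass_bound {Ω : Set E2} (f : ℕ → E2 → ℝ) (μ : Measure E2) [IsFiniteMeasure μ]
    {x₀ : E2} {ρ θ : ℝ} (hρ : 0 < ρ) (hsub : closedBall x₀ (8 * ρ) ⊆ Ω)
    (hfc : ∀ i, ContinuousOn (f i) Ω) (hf0 : ∀ i, ∀ y ∈ Ω, 0 ≤ f i y)
    (hΩm : MeasurableSet Ω)
    (hconv : ∀ φ : E2 → ℝ, ContinuousOn φ (closure Ω) →
      Tendsto (fun i => ∫ x in Ω, f i x * φ x) atTop (𝓝 (∫ x in closure Ω, φ x ∂μ)))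
    (hθ : μ.real (closedBall x₀ (5 * ρ)) < θ) :
    ∃ N, ∀ i ≥ N, ∫ y in ball x₀ (4 * ρ), f i y ≤ θ := by
  set φ : E2 → ℝ := fun y => max 0 (min 1 (5 - dist y x₀ / ρ)) with hφ
  have hφc : Continuous φ := by rw [hφ]; fun_prop
  have hφ0 : ∀ y, 0 ≤ φ y := fun y => le_max_left _ _
  have hφ1 : ∀ y, φ y ≤ 1 := fun y => max_le zero_le_one (min_le_left _ _)
  have hφin : ∀ y ∈ ball x₀ (4 * ρ), φ y = 1 := by
    intro y hy
    have : dist y x₀ / ρ ≤ 4 := by rw [div_le_iff₀ hρ]; exact (mem_ball.1 hy).le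
    have h : (1 : ℝ) ≤ 5 - dist y x₀ / ρ := by linarith
    simp [hφ, min_eq_left h]
  have hφout : ∀ y ∉ closedBall x₀ (5 * ρ), φ y = 0 := by
    intro y hy
    have hy' : 5 * ρ < dist y x₀ := by simpa using hy
    have : 5 ≤ dist y x₀ / ρ := by rw [le_div_iff₀ hρ]; exact hy'.le
    have h : 5 - dist y x₀ / ρ ≤ 0 := by linarith
    simp only [hφ]
    exact max_eq_left ((min_le_right _ _).trans h)
  have hlim : ∫ x in closure Ω, φ x ∂μ < θ := by
    refine lt_of_le_of_lt ?_ hθ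
    have hi : Integrable ((closedBall x₀ (5 * ρ)).indicator fun _ => (1 : ℝ))
        (μ.restrict (closure Ω)) :=
      (integrable_const 1).indicator measurableSet_closedBall
    calc _ ≤ ∫ x in closure Ω, (closedBall x₀ (5 * ρ)).indicator (fun _ => (1 : ℝ)) x ∂μ := by
          refine integral_mono_of_nonneg (Eventually.of_forall hφ0) hi
            (Eventually.of_forall fun y => ?_)
          by_cases hy : y ∈ closedBall x₀ (5 * ρ)
          · simpa [indicator_of_mem hy] using hφ1 y
          · simp [indicator_of_notMem hy, hφout y hy]
      _ = (μ.restrict (closure Ω)).real (closedBall x₀ (5 * ρ)) := by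
          rw [integral_indicator measurableSet_closedBall]; simp
      _ ≤ _ := by
          refine ENNReal.toReal_mono (measure_ne_top _ _) (Measure.restrict_apply_le _ _)
  have hev := (hconv φ hφc.continuousOn).eventually (gt_mem_nhds hlim)
  obtain ⟨N, hN⟩ := eventually_atTop.1 hev
  refine ⟨N, fun i hi => ?_⟩
  have h5 : closedBall x₀ (5 * ρ) ⊆ Ω :=
    (closedBall_subset_closedBall (by linarith)).trans hsub
  have h45 : ball x₀ (4 * ρ) ⊆ closedBall x₀ (5 * ρ) :=
    ball_subset_closedBall.trans (closedBall_subset_closedBall (by linarith))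
  have hint : IntegrableOn (fun y => f i y * φ y) (closedBall x₀ (5 * ρ)) :=
    (((hfc i).mono h5).mul hφc.continuousOn).integrableOn_compact (isCompact_closedBall _ _)
  calc ∫ y in ball x₀ (4 * ρ), f i y = ∫ y in ball x₀ (4 * ρ), f i y * φ y :=
        setIntegral_congr_fun measurableSet_ball fun y hy => by simp [hφin y hy]
    _ ≤ ∫ y in closedBall x₀ (5 * ρ), f i y * φ y := by
        refine setIntegral_mono_set hint ?_ h45.eventuallyLE
        filter_upwards [ae_restrict_mem measurableSet_closedBall] with y hy
        exact mul_nonneg (hf0 i y (h5 hy)) (hφ0 y)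
    _ = ∫ y in Ω, f i y * φ y :=
        (setIntegral_eq_of_subset_of_forall_diff_eq_zero hΩm h5 fun y hy => by
          simp [hφout y hy.2]).symm
    _ ≤ θ := (hN i hi).le

lemma finite_bound (w : ℕ → E2 → ℝ) {S : Set E2} (hS : IsCompact S)
    (hw : ∀ i, ContinuousOn (w i) S) (N : ℕ) : ∃ C : ℝ, ∀ i < N, ∀ x ∈ S, w i x ≤ C := by
  have h : ∀ i, ∃ M, ∀ x ∈ S, w i x ≤ M := fun i => by
    obtain ⟨M, hM⟩ := hS.bddAbove_image (hw i)
    exact ⟨M, fun x hx => hM ⟨x, hx, rfl⟩⟩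
  choose M hM using h
  refine ⟨∑ i ∈ Finset.range N, |M i|, fun i hi x hx => ?_⟩
  calc w i x ≤ M i := hM i x hx
    _ ≤ |M i| := le_abs_self _
    _ ≤ _ := Finset.single_le_sum (f := fun i => |M i|) (fun j _ => abs_nonneg _)
      (Finset.mem_range.2 hi)

/-- **Interior small-mass regularity.** If the measures `V_i e^{v_i} dx` converge weakly-*
(against continuous functions on `Ω̄`) to a finite measure `μ₁` and an interior point `x₀ ∈ Ω`
has `μ₁({x₀}) < 4π`, then `u_i` and `v_i` are uniformly bounded on a small ball around `x₀`. -/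
theorem interior_small_mass_regularity (Ω : Set E2) (hΩo : IsOpen Ω)
    (hΩb : Bornology.IsBounded Ω) (hΩs : SmoothBoundary Ω)
    (b₁ b₂ C₁ C₂ : ℝ) (V W u v : ℕ → E2 → ℝ)
    (hureg : ∀ i, ContDiffOn ℝ 2 (u i) (closure Ω))
    (hvreg : ∀ i, ContDiffOn ℝ 2 (v i) (closure Ω))
    (hequ : ∀ i, ∀ x ∈ Ω, -lap (u i) x = V i x * Real.exp (v i x))
    (heqv : ∀ i, ∀ x ∈ Ω, -lap (v i) x = W i x * Real.exp (u i x))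
    (hubd : ∀ i, ∀ x ∈ frontier Ω, u i x = 0)
    (hvbd : ∀ i, ∀ x ∈ frontier Ω, v i x = 0)
    (hV : ∀ i, ∀ x ∈ Ω, 0 ≤ V i x ∧ V i x ≤ b₁)
    (hW : ∀ i, ∀ x ∈ Ω, 0 ≤ W i x ∧ W i x ≤ b₂)
    (hIu : ∀ i, (∫ x in Ω, Real.exp (u i x)) ≤ C₁)
    (hIv : ∀ i, (∫ x in Ω, Real.exp (v i x)) ≤ C₂)
    (μ₁ : Measure E2) [IsFiniteMeasure μ₁]
    (hconv : ∀ φ : E2 → ℝ, ContinuousOn φ (closure Ω) →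
      Tendsto (fun i => ∫ x in Ω, V i x * Real.exp (v i x) * φ x) atTop
        (𝓝 (∫ x in closure Ω, φ x ∂μ₁)))
    (x₀ : E2) (hx₀ : x₀ ∈ Ω) (hmass : μ₁ {x₀} < ENNReal.ofReal (4 * π)) :
    ∃ R > (0 : ℝ), Metric.ball x₀ R ⊆ Ω ∧
      ∃ C : ℝ, ∀ i, ∀ x ∈ Metric.ball x₀ R, u i x ≤ C ∧ v i x ≤ C := by
  have hfu : ∀ i, ∀ y ∈ Ω, 0 ≤ -lap (u i) y := fun i y hy => by
    rw [hequ i y hy]; exact mul_nonneg (hV i y hy).1 (Real.exp_pos _).le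
  have hfv : ∀ i, ∀ y ∈ Ω, 0 ≤ -lap (v i) y := fun i y hy => by
    rw [heqv i y hy]; exact mul_nonneg (hW i y hy).1 (Real.exp_pos _).le
  have hcu : ∀ i, ContinuousOn (fun y => -lap (u i) y) Ω := fun i =>
    (lap_contOn hΩo ((hureg i).mono subset_closure)).neg
  have hcv : ∀ i, ContinuousOn (fun y => -lap (v i) y) Ω := fun i =>
    (lap_contOn hΩo ((hvreg i).mono subset_closure)).neg
  have hb₁ : 0 ≤ b₁ := (hV 0 x₀ hx₀).1.trans (hV 0 x₀ hx₀).2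
  have hb₂ : 0 ≤ b₂ := (hW 0 x₀ hx₀).1.trans (hW 0 x₀ hx₀).2
  obtain ⟨ρ, hρ, hρΩ, hρm⟩ := exists_radius hΩo μ₁ hx₀ hmass
  set L := μ₁.real (closedBall x₀ (5 * ρ)) with hL
  have hL0 : 0 ≤ L := measureReal_nonneg
  have hpi := pi_pos
  obtain ⟨θ, hθ⟩ : ∃ θ, θ = (L + 4 * π) / 2 := ⟨_, rfl⟩
  have hθ0 : 0 < θ := by linarith
  have hθ4 : θ < 4 * π := by linarith
  have hLθ : L < θ := by linarith
  obtain ⟨β, hβ⟩ : ∃ β, β = θ / (2 * π) := ⟨_, rfl⟩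
  have hβ0 : 0 < β := by rw [hβ]; positivity
  have hβ2 : β < 2 := by rw [hβ, div_lt_iff₀ (by positivity)]; linarith
  obtain ⟨N, hN⟩ := exists_mass_bound (fun i y => -lap (u i) y) μ₁ hρ hρΩ hcu hfu
    hΩo.measurableSet (by
      intro φ hφ
      refine (hconv φ hφ).congr fun i => ?_
      refine setIntegral_congr_fun hΩo.measurableSet fun y hy => ?_
      simp only [hequ i y hy]) hLθ
  have hballs : ∀ {s t : ℝ} {x : E2}, x ∈ ball x₀ s → closedBall x t ⊆ ball x₀ (s + t) := by
    intro s t x hx y hy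
    rw [mem_ball] at hx ⊢
    rw [mem_closedBall] at hy
    linarith [dist_triangle y x x₀]
  have hbΩ : ∀ s, s ≤ 8 * ρ → ball x₀ s ⊆ Ω := fun s hs =>
    (ball_subset_closedBall.trans (closedBall_subset_closedBall hs)).trans hρΩ
  have hcl : ∀ x ∈ ball x₀ (3 * ρ), closedBall x (2 * ρ) ⊆ Ω := fun x hx =>
    (hballs hx).trans (hbΩ _ (by linarith))
  have hcl1 : ∀ x ∈ ball x₀ (3 * ρ), closedBall x ρ ⊆ Ω := fun x hx =>
    (hballs hx).trans (hbΩ _ (by linarith))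
  set A : ℝ := 2 / (π * ρ ^ 2) with hA
  -- step 1
  have step1 : ∀ i ≥ N, ∀ z ∈ ball x₀ (3 * ρ), Real.exp (u i z) ≤ Real.exp (A * C₁) *
      (1 + 1 / θ * ∫ y in ball z ρ, (ρ / ‖y - z‖) ^ β * (-lap (u i) y)) := by
    intro i hi z hz
    have hK := K_use hΩo hΩb (hureg i) (hIu i) hρ (hcl z hz) (hfu i)
    have hzΩ : ball z ρ ⊆ Ω := ball_subset_closedBall.trans (hcl1 z hz)
    have hfi : IntegrableOn (fun y => -lap (u i) y) (ball x₀ (4 * ρ)) :=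
      (((hcu i).mono ((closedBall_subset_closedBall (by linarith)).trans hρΩ)).integrableOn_compact
        (isCompact_closedBall x₀ (4 * ρ))).mono_set ball_subset_closedBall
    have hz4 : ball z ρ ⊆ ball x₀ (4 * ρ) :=
      (ball_subset_closedBall.trans (hballs hz)).trans (ball_subset_ball (by linarith))
    have hJ := jensen_tan (S := ball z ρ) measurableSet_ball (f := fun y => -lap (u i) y)
      (h := fun y => β * Real.log (ρ / ‖y - z‖)) (k := fun y => (ρ / ‖y - z‖) ^ β) hθ0
      (fun y hy => hfu i y (hzΩ hy))
      (fun y hy => mul_nonneg hβ0.le (log_nonneg_ball z y hy))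
      (by
        have h0 : ∀ᵐ y : E2, y ≠ z := by rw [ae_iff]; simp
        filter_upwards [h0] with y hy _
        have : 0 < ‖y - z‖ := by rwa [norm_pos_iff, sub_ne_zero]
        rw [Real.rpow_def_of_pos (by positivity), mul_comm])
      (hfi.mono_set hz4)
      (by
        have := (int_log_mul hρ ((hcu i).mono (hcl1 z hz))).const_mul β
        simpa only [mul_assoc, IntegrableOn] using this)
      ((kern_int_at hβ2 hρ z).mul_continuousOn_of_subset ((hcu i).mono (hcl1 z hz))
        measurableSet_ball (isCompact_closedBall z ρ) ball_subset_closedBall)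
      ((setIntegral_mono_set hfi (by
        filter_upwards [ae_restrict_mem measurableSet_ball] with y hy
        exact hfu i y (hbΩ _ (by linarith) hy)) hz4.eventuallyLE).trans (hN i hi))
    have e : 1 / θ * ∫ y in ball z ρ, β * Real.log (ρ / ‖y - z‖) * (-lap (u i) y) =
        1 / (2 * π) * ∫ y in ball z ρ, Real.log (ρ / ‖y - z‖) * (-lap (u i) y) := by
      simp only [mul_assoc]
      rw [integral_const_mul, hβ]
      field_simp
    rw [e] at hJ
    calc Real.exp (u i z) ≤ Real.exp (A * C₁ +
          1 / (2 * π) * ∫ y in ball z ρ, Real.log (ρ / ‖y - z‖) * (-lap (u i) y)) :=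
          Real.exp_le_exp.2 hK
      _ ≤ _ := by
          rw [Real.exp_add]
          exact mul_le_mul_of_nonneg_left hJ (Real.exp_pos _).le
  -- step 2
  obtain ⟨C, hC⟩ := conv_bound hρ hβ0 hβ2 hθ0 (Real.exp_pos (A * C₁)).le
  obtain ⟨Cv, hCv⟩ : ∃ Cv, Cv = A * C₂ + 1 / (2 * π) * (b₂ * C) := ⟨_, rfl⟩
  have step2 : ∀ i ≥ N, ∀ x ∈ ball x₀ (2 * ρ), v i x ≤ Cv := by
    intro i hi x hx
    have hx3 : x ∈ ball x₀ (3 * ρ) := ball_subset_ball (by linarith) hx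
    have hb3 : ball x ρ ⊆ ball x₀ (3 * ρ) :=
      (ball_subset_closedBall.trans (hballs hx)).trans (ball_subset_ball (by linarith))
    have hK := K_use hΩo hΩb (hvreg i) (hIv i) hρ (hcl x hx3) (hfv i)
    have hfi : IntegrableOn (fun y => -lap (u i) y) (ball x₀ (4 * ρ)) :=
      (((hcu i).mono ((closedBall_subset_closedBall (by linarith)).trans hρΩ)).integrableOn_compact
        (isCompact_closedBall x₀ (4 * ρ))).mono_set ball_subset_closedBall
    have hCi := hC x (ball x₀ (4 * ρ)) (u i) (fun y => -lap (u i) y) measurableSet_ball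
      (fun y hy => hfu i y (hbΩ _ (by linarith) hy)) hfi (hN i hi)
      (fun z hz => (ball_subset_closedBall.trans (hballs (hb3 hz))).trans
        (ball_subset_ball (by linarith)))
      (fun z hz => step1 i hi z (hb3 hz))
    have hec : ContinuousOn (fun y => Real.exp (u i y)) (closedBall x ρ) :=
      Real.continuous_exp.comp_continuousOn
        ((hureg i).continuousOn.mono ((hcl1 x hx3).trans subset_closure))
    have hle : ∫ y in ball x ρ, Real.log (ρ / ‖y - x‖) * (-lap (v i) y) ≤ b₂ * C := by
      calc _ ≤ ∫ y in ball x ρ, b₂ * (Real.log (ρ / ‖y - x‖) * Real.exp (u i y)) := by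
            refine setIntegral_mono_on (int_log_mul hρ ((hcv i).mono (hcl1 x hx3)))
              ((int_log_mul hρ hec).const_mul _) measurableSet_ball fun y hy => ?_
            have hyΩ : y ∈ Ω := hbΩ _ (by linarith) (hb3 hy)
            rw [heqv i y hyΩ, mul_left_comm b₂]
            exact mul_le_mul_of_nonneg_left
              (mul_le_mul_of_nonneg_right (hW i y hyΩ).2 (Real.exp_pos _).le)
              (log_nonneg_ball x y hy)
        _ = b₂ * ∫ y in ball x ρ, Real.log (ρ / ‖y - x‖) * Real.exp (u i y) :=
            integral_const_mul _ _
        _ ≤ _ := mul_le_mul_of_nonneg_left hCi hb₂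
    rw [hCv]
    refine hK.trans ?_
    gcongr
  -- step 3
  set I : ℝ := ∫ y in ball (0 : E2) ρ, Real.log (ρ / ‖y‖) with hI
  obtain ⟨Cu, hCu⟩ : ∃ Cu, Cu = A * C₁ + 1 / (2 * π) * ((b₁ * Real.exp Cv) * I) := ⟨_, rfl⟩
  have step3 : ∀ i ≥ N, ∀ x ∈ ball x₀ ρ, u i x ≤ Cu := by
    intro i hi x hx
    have hx3 : x ∈ ball x₀ (3 * ρ) := ball_subset_ball (by linarith) hx
    have hb2 : ball x ρ ⊆ ball x₀ (2 * ρ) :=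
      (ball_subset_closedBall.trans (hballs hx)).trans (ball_subset_ball (by linarith))
    have hK := K_use hΩo hΩb (hureg i) (hIu i) hρ (hcl x hx3) (hfu i)
    have ht := setInt_translate (fun y => Real.log (ρ / ‖y - x‖)) x ρ
    simp only [add_sub_cancel_right] at ht
    have hle : ∫ y in ball x ρ, Real.log (ρ / ‖y - x‖) * (-lap (u i) y) ≤
        (b₁ * Real.exp Cv) * I := by
      calc _ ≤ ∫ y in ball x ρ, (b₁ * Real.exp Cv) * Real.log (ρ / ‖y - x‖) := by
            refine setIntegral_mono_on (int_log_mul hρ ((hcu i).mono (hcl1 x hx3)))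
              ((log_int_at hρ x).const_mul _) measurableSet_ball fun y hy => ?_
            have hyΩ : y ∈ Ω := hbΩ _ (by linarith) (hb2 hy)
            rw [hequ i y hyΩ, mul_comm]
            refine mul_le_mul_of_nonneg_right ?_ (log_nonneg_ball x y hy)
            exact mul_le_mul (hV i y hyΩ).2 (Real.exp_le_exp.2 (step2 i hi y (hb2 hy)))
              (Real.exp_pos _).le hb₁
        _ = _ := by rw [integral_const_mul, hI, ht]
    rw [hCu]
    refine hK.trans ?_
    gcongr
  -- finitely many remaining indices
  have hSΩ : closedBall x₀ ρ ⊆ closure Ω :=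
    ((closedBall_subset_closedBall (by linarith)).trans hρΩ).trans subset_closure
  obtain ⟨D1, hD1⟩ := finite_bound u (isCompact_closedBall x₀ ρ)
    (fun i => (hureg i).continuousOn.mono hSΩ) N
  obtain ⟨D2, hD2⟩ := finite_bound v (isCompact_closedBall x₀ ρ)
    (fun i => (hvreg i).continuousOn.mono hSΩ) N
  refine ⟨ρ, hρ, hbΩ _ (by linarith), max (max Cu Cv) (max D1 D2), fun i x hx => ?_⟩
  by_cases hi : i < N
  · have hx' := ball_subset_closedBall hx
    exact ⟨(hD1 i hi x hx').trans ((le_max_left _ _).trans (le_max_right _ _)),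
      (hD2 i hi x hx').trans ((le_max_right _ _).trans (le_max_right _ _))⟩
  · have hi' : N ≤ i := not_lt.1 hi
    exact ⟨(step3 i hi' x hx).trans ((le_max_left _ _).trans (le_max_left _ _)),
      (step2 i hi' x (ball_subset_ball (by linarith) hx)).trans
        ((le_max_right _ _).trans (le_max_left _ _))⟩
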